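/- Let 𝒮 be a nonempty finite set, let F(·, ξ) : ℝⁿ → ℝ be continuously differentiable for each ξ ∈ 𝒮, let f(x) = (1/|𝒮|) Σ_{ξ∈𝒮} F(x, ξ), and for nonempty S ⊆ 𝒮 let g_S(x) = (1/|S|) Σ_{ξ∈S} ∇F(x, ξ). Let μ > 0, let (x_k)_{k≥0} ⊆ ℝⁿ, let (D_k)_{k≥0} be a nonnegative real sequence, let S_k ⊆ 𝒮 be nonempty (k ≥ 1), γ_k ∈ [0, γ] with γ < 1, and ε_k ≥ 0. Assume: (i) D_k ≤ γ_k D_{k−1} + ε_k + (1/μ) ‖∇f(x_k) − g_{S_k}(x_k)‖ + (γ_k/μ) ‖∇f(x_{k−1}) − g_{S_k}(x_{k−1})‖ for all k ≥ 1; (ii) ‖∇F(x, ξ)‖² ≤ ω₁² ‖∇f(x)‖² + ω₂² for all x ∈ ℝⁿ, ξ ∈ 𝒮; (iii) ‖∇f(x_k)‖ ≤ κ_g for all k ≥ 0; (iv) ε_k → 0 and |S_k| → |𝒮| as k → ∞. Then D_k → 0 as k → ∞. -/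

import Mathlib

/-- Finite-sum objective: `f(x) = (1/|𝒮|) Σ_{ξ∈𝒮} F(x, ξ)`. -/
noncomputable def favg {n : ℕ} {ι : Type*} [Fintype ι]
    (F : ι → EuclideanSpace ℝ (Fin n) → ℝ) (x : EuclideanSpace ℝ (Fin n)) : ℝ :=
  (1 / (Fintype.card ι : ℝ)) * ∑ ξ, F ξ x

/-- Subsampled gradient: `g_S(x) = (1/|S|) Σ_{ξ∈S} ∇F(x, ξ)`. -/
noncomputable def gsub {n : ℕ} {ι : Type*}
    (F : ι → EuclideanSpace ℝ (Fin n) → ℝ) (S : Finset ι)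
    (x : EuclideanSpace ℝ (Fin n)) : EuclideanSpace ℝ (Fin n) :=
  (1 / (S.card : ℝ)) • ∑ ξ ∈ S, gradient (F ξ) x

/-- The gradient of the finite-sum objective is the full-batch gradient. -/
lemma gradient_favg {n : ℕ} {ι : Type*} [Fintype ι]
    (F : ι → EuclideanSpace ℝ (Fin n) → ℝ) (x : EuclideanSpace ℝ (Fin n))
    (hF : ∀ ξ, DifferentiableAt ℝ (F ξ) x) :
    gradient (favg F) x = gsub F Finset.univ x := by
  refine HasGradientAt.gradient ?_
  rw [hasGradientAt_iff_hasFDerivAt]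
  have h := (HasFDerivAt.fun_sum (u := Finset.univ)
    fun ξ _ => (hF ξ).hasGradientAt.hasFDerivAt).const_mul (1 / (Fintype.card ι : ℝ))
  change HasFDerivAt (fun y => favg F y) _ x
  simpa [gsub, favg, map_sum] using h

/-- A nonnegative sequence satisfying an eventual contraction up to a vanishing perturbation
tends to zero. -/
lemma tendsto_zero_of_eventually_le_mul_add {u e : ℕ → ℝ} {c : ℝ} (hu : ∀ k, 0 ≤ u k)
    (hc : 0 ≤ c) (hc1 : c < 1) (he : Filter.Tendsto e Filter.atTop (nhds 0))
    (h : ∀ᶠ k in Filter.atTop, u (k + 1) ≤ c * u k + e k) :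
    Filter.Tendsto u Filter.atTop (nhds 0) := by
  refine tendsto_order.2 ⟨fun a ha => .of_forall fun k => ha.trans_le (hu k), fun η hη => ?_⟩
  have hpos : 0 < (1 - c) * (η / 2) := mul_pos (by linarith) (by linarith)
  obtain ⟨K, hK⟩ := Filter.eventually_atTop.1 (h.and (he.eventually_lt_const hpos))
  have hle : ∀ m, u (m + K) ≤ c ^ m * u K + η / 2 := by
    intro m
    induction m with
    | zero => simpa using by linarith
    | succ m ih =>
      obtain ⟨h1, h2⟩ := hK (m + K) (by omega)
      have h3 := mul_le_mul_of_nonneg_left ih hc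
      rw [show m + 1 + K = m + K + 1 by omega, pow_succ]
      linarith
  have hlim : Filter.Tendsto (fun m => c ^ m * u K + η / 2) Filter.atTop (nhds (η / 2)) := by
    simpa using ((tendsto_pow_atTop_nhds_zero_of_lt_one hc hc1).mul_const (u K)).add_const (η / 2)
  obtain ⟨M, hM⟩ := Filter.eventually_atTop.1 (hlim.eventually_lt_const (half_lt_self hη))
  refine Filter.eventually_atTop.2 ⟨M + K, fun k hk => ?_⟩
  have := (hle (k - K)).trans_lt (hM (k - K) (by omega))
  rwa [Nat.sub_add_cancel (by omega)] at this

/-- Theorem 3.1(1): convergence of the true robust-SQP search-direction norms `D k`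
to zero for the inequality-constrained RA-SQP method (finite-sum case). -/
theorem ra_inequality_finite_sum_convergence
    {n : ℕ} {ι : Type*} [Fintype ι] [Nonempty ι]
    (F : ι → EuclideanSpace ℝ (Fin n) → ℝ) (hF : ∀ ξ, ContDiff ℝ 1 (F ξ))
    (μ : ℝ) (hμ : 0 < μ)
    (x : ℕ → EuclideanSpace ℝ (Fin n))
    (D : ℕ → ℝ) (hD : ∀ k, 0 ≤ D k)
    (S : ℕ → Finset ι) (hS : ∀ k, (S (k + 1)).Nonempty)
    (γk : ℕ → ℝ) (γ : ℝ) (hγk : ∀ k, 0 ≤ γk k ∧ γk k ≤ γ) (hγ : γ < 1)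
    (εk : ℕ → ℝ) (hεk : ∀ k, 0 ≤ εk k)
    -- (i) recursion from Lemma 3.1:
    (hrec : ∀ k, D (k + 1)
      ≤ γk (k + 1) * D k + εk (k + 1)
        + (1 / μ) * ‖gradient (favg F) (x (k + 1)) - gsub F (S (k + 1)) (x (k + 1))‖
        + (γk (k + 1) / μ) * ‖gradient (favg F) (x k) - gsub F (S (k + 1)) (x k)‖)
    -- (ii) bounded individual component gradients:
    (ω₁ ω₂ : ℝ) (hω₁ : 0 ≤ ω₁) (hω₂ : 0 ≤ ω₂)
    (hgradbound : ∀ (y : EuclideanSpace ℝ (Fin n)) (ξ : ι),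
      ‖gradient (F ξ) y‖ ^ 2 ≤ ω₁ ^ 2 * ‖gradient (favg F) y‖ ^ 2 + ω₂ ^ 2)
    -- (iii) bounded true gradients along the iterates:
    (κg : ℝ) (hκg : 0 ≤ κg)
    (hbound : ∀ k, ‖gradient (favg F) (x k)‖ ≤ κg)
    -- (iv) vanishing tolerances and full batches in the limit:
    (hε0 : Filter.Tendsto εk Filter.atTop (nhds 0))
    (hScard : Filter.Tendsto (fun k => ((S k).card : ℝ)) Filter.atTop
      (nhds (Fintype.card ι))) :
    Filter.Tendsto D Filter.atTop (nhds 0) := by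
  have hgrad : ∀ y, gradient (favg F) y = gsub F Finset.univ y := fun y =>
    gradient_favg F y fun ξ => (hF ξ).differentiable one_ne_zero y
  have hfull : ∀ᶠ k in Filter.atTop, S k = Finset.univ := by
    have hlt : (Fintype.card ι : ℝ) - 1 < Fintype.card ι := by linarith
    filter_upwards [hScard.eventually_const_lt hlt] with k hk
    have hk' : Fintype.card ι < (S k).card + 1 := by
      have : (Fintype.card ι : ℝ) < (S k).card + 1 := by linarith
      exact_mod_cast this
    exact Finset.eq_univ_of_card _ (le_antisymm (Finset.card_le_univ _) (by omega))
  refine tendsto_zero_of_eventually_le_mul_add hD ((hγk 0).1.trans (hγk 0).2) hγ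
    ((Filter.tendsto_add_atTop_iff_nat 1).2 hε0) ?_
  filter_upwards [(Filter.tendsto_add_atTop_nat 1).eventually hfull] with k hk
  have h := hrec k
  rw [hk, hgrad, hgrad, sub_self, sub_self, norm_zero, mul_zero, mul_zero] at h
  linarith [mul_le_mul_of_nonneg_right (hγk (k + 1)).2 (hD k)]
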